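/- arXiv:2511.15834 — 2 statements merged into one kernel-verified Lean document; each statement's English description precedes it below -/
import Mathlib

section
/- For a prime p ≥ 5, the number of equivalence classes up to rotation of Hamiltonian cycles on Z/p having exactly one axis of reflective symmetry equals ((p-1)/2) · (2^((p-3)/2) · ((p-3)/2)! − 1). -/
open Equiv
set_option linter.unusedSectionVars false

variable (p : ℕ) [NeZero p]

/-- `σ` is a (directed) Hamiltonian cycle on the `p` vertices `ZMod p`:
a single cycle whose support is everything. -/
def IsHC (σ : Perm (ZMod p)) : Prop := σ.IsCycle ∧ σ.support = Finset.univ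

/-- The type of directed Hamiltonian cycles on `ZMod p`. -/
def HC := {σ : Perm (ZMod p) // IsHC p σ}

/-- Rotation `k ↦ r + k`. -/
def rot (r : ZMod p) : Perm (ZMod p) := Equiv.addLeft r

/-- Reflection `k ↦ s - k`. -/
def reflAt (s : ZMod p) : Perm (ZMod p) := Equiv.subLeft s

/-- `g` fixes the *undirected* cycle underlying `σ` (conjugation can reverse orientation). -/
def FixedBy (g σ : Perm (ZMod p)) : Prop := g * σ * g⁻¹ = σ ∨ g * σ * g⁻¹ = σ⁻¹

lemma rot_zero : rot p 0 = 1 := by ext x; simp [rot]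

lemma rot_neg (r : ZMod p) : rot p (-r) = (rot p r)⁻¹ := by
  ext x; simp [rot, neg_add_eq_sub, eq_sub_iff_add_eq]

lemma rot_add (r s : ZMod p) : rot p (r + s) = rot p r * rot p s := by
  ext x; simp [rot, add_assoc]

/-- The action of a rotation on a cycle, by conjugation. -/
def rotAct (r : ZMod p) (σ : Perm (ZMod p)) : Perm (ZMod p) := rot p r * σ * (rot p r)⁻¹

lemma rotAct_zero (σ : Perm (ZMod p)) : rotAct p 0 σ = σ := by
  simp [rotAct, rot_zero]

lemma rotAct_inv (r : ZMod p) (σ : Perm (ZMod p)) :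
    (rotAct p r σ)⁻¹ = rotAct p r σ⁻¹ := by
  simp [rotAct, mul_inv_rev, mul_assoc]

lemma rotAct_rotAct (r s : ZMod p) (σ : Perm (ZMod p)) :
    rotAct p r (rotAct p s σ) = rotAct p (r + s) σ := by
  simp [rotAct, rot_add, mul_inv_rev, mul_assoc]

lemma rotAct_neg_cancel (r : ZMod p) (σ : Perm (ZMod p)) :
    rotAct p (-r) (rotAct p r σ) = σ := by
  rw [rotAct_rotAct, neg_add_cancel, rotAct_zero]

/-- Setoid identifying a directed cycle with its reversal: undirected cycles. -/
def revSetoid : Setoid (HC p) where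
  r σ τ := τ.1 = σ.1 ∨ τ.1 = σ.1⁻¹
  iseqv := by
    constructor
    · exact fun a => Or.inl rfl
    · rintro a b (h | h)
      · exact Or.inl h.symm
      · right; rw [h, inv_inv]
    · rintro a b c (h1 | h1) (h2 | h2) <;> rw [h2, h1] <;> simp
/-- Undirected Hamiltonian cycles. -/
def UCyc := Quotient (revSetoid p)

/-- Setoid identifying cycles up to rotation and reversal: the equivalence classes
of undirected cycles under rotation. -/
def rotSetoid : Setoid (HC p) where
  r σ τ := ∃ r : ZMod p, τ.1 = rotAct p r σ.1 ∨ τ.1 = (rotAct p r σ.1)⁻¹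
  iseqv := by
    constructor
    · exact fun a => ⟨0, Or.inl (by rw [rotAct_zero])⟩
    · rintro a b ⟨r, h | h⟩ <;> refine ⟨-r, ?_⟩
      · left; rw [h, rotAct_neg_cancel]
      · right; rw [h, rotAct_inv, inv_inv, rotAct_neg_cancel]
    · rintro a b c ⟨r, h1 | h1⟩ ⟨s, h2 | h2⟩ <;> refine ⟨s + r, ?_⟩ <;>
        rw [h2, h1] <;>
        simp [rotAct_inv, rotAct_rotAct]
/-- Rotation classes of undirected Hamiltonian cycles. -/
def RotClasses := Quotient (rotSetoid p)

section helpers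

variable {p : ℕ} [Fact p.Prime]

lemma hc_order {σ : Perm (ZMod p)} (h : IsHC p σ) : orderOf σ = p := by
  rw [h.1.orderOf, h.2, Finset.card_univ, ZMod.card]

lemma two_ne (hp : 5 ≤ p) : (2 : ZMod p) ≠ 0 := by
  intro h
  have : ((2 : ℕ) : ZMod p) = 0 := by exact_mod_cast h
  rw [ZMod.natCast_eq_zero_iff] at this
  have := Nat.le_of_dvd (by norm_num) this
  omega

/-- `s` is an (orientation reversing) axis. -/
def Ax (s : ZMod p) (σ : Perm (ZMod p)) : Prop := ∀ x, σ (s - σ x) = s - x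

/-- star polygons -/
def IsStarPoly (σ : Perm (ZMod p)) : Prop := ∀ x, σ (x + 1) = σ x + 1

lemma refl_conj_iff (s : ZMod p) (σ : Perm (ZMod p)) :
    reflAt p s * σ * (reflAt p s)⁻¹ = σ⁻¹ ↔ Ax s σ := by
  rw [mul_inv_eq_iff_eq_mul, eq_inv_mul_iff_mul_eq, Equiv.ext_iff]
  rfl

lemma refl_ne_one (hp : 5 ≤ p) (s : ZMod p) : reflAt p s ≠ 1 := by
  intro h
  have h0 : s - 0 = 0 := Equiv.ext_iff.1 h 0
  have h1 : s - 1 = 1 := Equiv.ext_iff.1 h 1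
  apply two_ne hp
  linear_combination h0 - h1

lemma commute_hc {σ g : Perm (ZMod p)} (h : IsHC p σ) (hg : g * σ = σ * g) :
    ∃ n : ℕ, g = σ ^ n := by
  have hs : ∀ x, σ x ≠ x := fun x => by
    have : x ∈ σ.support := by rw [h.2]; exact Finset.mem_univ _
    exact Equiv.Perm.mem_support.1 this
  obtain ⟨n, hn⟩ := h.1.exists_pow_eq (hs 0) (hs (g 0))
  refine ⟨n, ?_⟩
  have hg' : Commute g σ := hg
  ext x
  obtain ⟨k, rfl⟩ := h.1.exists_pow_eq (hs 0) (hs x)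
  have e1 : g ((σ ^ k) 0) = (σ ^ k) (g 0) := Equiv.ext_iff.1 (hg'.pow_right k) 0
  rw [e1, ← hn, ← Equiv.Perm.mul_apply, ← Equiv.Perm.mul_apply, ← pow_add, ← pow_add, add_comm]

lemma fixedBy_iff (hp : 5 ≤ p) (s : ZMod p) {σ : Perm (ZMod p)} (h : IsHC p σ) :
    FixedBy p (reflAt p s) σ ↔ Ax s σ := by
  rw [← refl_conj_iff]
  refine ⟨?_, Or.inr⟩
  rintro (h1 | h1)
  · exfalso
    rw [mul_inv_eq_iff_eq_mul] at h1
    obtain ⟨n, hn⟩ := commute_hc h h1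
    have h2 : reflAt p s ^ 2 = 1 := by
      ext x
      simp [reflAt, pow_two]
    have hpw : σ ^ p = 1 := orderOf_dvd_iff_pow_eq_one.1 (by rw [hc_order h])
    have h3 : reflAt p s ^ p = 1 := by
      rw [hn, ← pow_mul, mul_comm, pow_mul, hpw, one_pow]
    have h4 : orderOf (reflAt p s) ∣ 2 := orderOf_dvd_of_pow_eq_one h2
    have h5 : orderOf (reflAt p s) ∣ p := orderOf_dvd_of_pow_eq_one h3
    have h6 : Nat.Coprime 2 p := (Nat.coprime_primes Nat.prime_two Fact.out).2 (by omega)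
    have h7 : orderOf (reflAt p s) = 1 := Nat.eq_one_of_dvd_coprimes h6 h4 h5
    exact refl_ne_one hp s (orderOf_eq_one_iff.1 h7)
  · exact h1

lemma star_add {σ : Perm (ZMod p)} {d : ZMod p} (hd : d ≠ 0) (h : ∀ x, σ (x + d) = σ x + d) :
    IsStarPoly σ := by
  have key : ∀ (n : ℕ) x, σ (x + n * d) = σ x + n * d := by
    intro n
    induction n with
    | zero => simp
    | succ k ih =>
      intro x
      have : x + ((k + 1 : ℕ) : ZMod p) * d = (x + k * d) + d := by push_cast; ring
      rw [this, h, ih]; push_cast; ring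
  intro x
  have := key (d⁻¹).val x
  rwa [ZMod.natCast_zmod_val, inv_mul_cancel₀ hd] at this

lemma star_eq {σ : Perm (ZMod p)} (h : IsStarPoly σ) (x : ZMod p) : σ x = σ 0 + x := by
  have key : ∀ n : ℕ, σ n = σ 0 + n := by
    intro n
    induction n with
    | zero => simp
    | succ k ih => push_cast; rw [h, ih]; ring
  have := key x.val
  rwa [ZMod.natCast_zmod_val] at this

lemma star_ax {σ : Perm (ZMod p)} (h : IsStarPoly σ) (s : ZMod p) : Ax s σ := by
  intro x
  rw [star_eq h, star_eq h x]; ring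

lemma ax_unique {σ : Perm (ZMod p)} {s t : ZMod p} (hs : Ax s σ) (ht : Ax t σ) (hst : s ≠ t) :
    IsStarPoly σ := by
  apply star_add (sub_ne_zero.2 hst)
  intro x
  -- σ (s - σ (t - σ ..))
  have h1 := ht (σ.symm (t - x))
  rw [Equiv.apply_symm_apply, sub_sub_cancel] at h1
  have h2 := hs (σ.symm (t - x))
  rw [Equiv.apply_symm_apply] at h2
  rw [h1, show x + (s - t) = s - (t - x) by ring, h2]; ring

lemma ncard_iff (hp : 5 ≤ p) {σ : Perm (ZMod p)} (h : IsHC p σ) :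
    {s : ZMod p | FixedBy p (reflAt p s) σ}.ncard = 1 ↔ (∃ s, Ax s σ) ∧ ¬ IsStarPoly σ := by
  have : {s : ZMod p | FixedBy p (reflAt p s) σ} = {s | Ax s σ} := by
    ext s; exact fixedBy_iff hp s h
  rw [this, Set.ncard_eq_one]
  constructor
  · rintro ⟨a, ha⟩
    refine ⟨⟨a, ?_⟩, fun hst => ?_⟩
    · have : a ∈ {s | Ax s σ} := by rw [ha]; rfl
      exact this
    · have h0 : (0 : ZMod p) ∈ {s | Ax s σ} := star_ax hst 0
      have h1 : (1 : ZMod p) ∈ {s | Ax s σ} := star_ax hst 1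
      rw [ha] at h0 h1
      exact zero_ne_one (h0.trans h1.symm)
  · rintro ⟨⟨a, ha⟩, hst⟩
    refine ⟨a, Set.eq_singleton_iff_unique_mem.2 ⟨ha, fun b hb => ?_⟩⟩
    by_contra hab
    exact hst (ax_unique hb ha hab)

lemma rotAct_apply (r : ZMod p) (σ : Perm (ZMod p)) (x : ZMod p) :
    rotAct p r σ x = r + σ (x - r) := by
  have : (rot p r)⁻¹ x = x - r := by
    rw [← rot_neg]; simp [rot]; ring
  simp only [rotAct, Equiv.Perm.mul_apply, this]
  rfl

lemma ax_rot {r s : ZMod p} {σ : Perm (ZMod p)} (h : Ax s σ) : Ax (s + 2 * r) (rotAct p r σ) := by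
  intro x
  rw [rotAct_apply, rotAct_apply, show s + 2 * r - (r + σ (x - r)) - r = s - σ (x - r) by ring, h]
  ring

lemma ax_inv {s : ZMod p} {σ : Perm (ZMod p)} (h : Ax s σ) : Ax s σ⁻¹ := by
  intro x
  have h2 := h (σ⁻¹ x)
  have h3 : σ (σ⁻¹ x) = x := σ.apply_symm_apply x
  rw [h3] at h2
  rw [← h2]
  exact σ.symm_apply_apply _

lemma star_rot {r : ZMod p} {σ : Perm (ZMod p)} (h : IsStarPoly (rotAct p r σ)) : IsStarPoly σ := by
  intro x
  have := h (x + r)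
  rw [rotAct_apply, rotAct_apply, show x + r + 1 - r = x + 1 by ring, add_sub_cancel_right] at this
  linear_combination this

lemma hc_conj {σ : Perm (ZMod p)} (h : IsHC p σ) (g : Perm (ZMod p)) : IsHC p (g * σ * g⁻¹) := by
  refine ⟨h.1.conj, ?_⟩
  rw [Equiv.Perm.support_conj, h.2]
  ext x; simp

lemma hc_inv {σ : Perm (ZMod p)} (h : IsHC p σ) : IsHC p σ⁻¹ :=
  ⟨h.1.inv, by rw [Equiv.Perm.support_inv, h.2]⟩

lemma hc_rot {c : ZMod p} (hc : c ≠ 0) : IsHC p (rot p c) := by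
  have hpow : ∀ n : ℕ, rot p c ^ n = rot p (n * c) := by
    intro n
    induction n with
    | zero => simp [rot_zero]
    | succ k ih => rw [pow_succ, ih, ← rot_add]; congr 1; push_cast; ring
  have ho : orderOf (rot p c) = p := by
    apply orderOf_eq_prime
    · rw [hpow]; simp [rot_zero]
    · intro h
      have := Equiv.ext_iff.1 h 0
      simp [rot] at this
      exact hc this
  have hpp : p.Prime := Fact.out
  refine ⟨Equiv.Perm.isCycle_of_prime_order' (by rw [ho]; exact hpp) ?_, ?_⟩
  · rw [ho, ZMod.card]; have := hpp.pos; omega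
  · ext x; simp [rot, hc]

/-- negation as a permutation -/
lemma card_centralizer (hp : 5 ≤ p) :
    Nat.card (Subgroup.centralizer {reflAt p 0}) = 2 ^ ((p - 1) / 2) * ((p - 1) / 2).factorial := by
  have hsup : (reflAt p 0).support.card = p - 1 := by
    have : (reflAt p 0).support = Finset.univ.erase 0 := by
      ext x
      simp only [Equiv.Perm.mem_support, Finset.mem_erase, Finset.mem_univ, and_true]
      apply not_congr
      change 0 - x = x ↔ _
      constructor
      · intro h
        have : 2 * x = 0 := by linear_combination -h
        exact (mul_eq_zero.1 this).resolve_left (two_ne hp)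
      · rintro rfl; simp
    rw [this, Finset.card_erase_of_mem (Finset.mem_univ _), Finset.card_univ, ZMod.card]
  have h2 : reflAt p 0 ^ 2 = 1 := by
    ext x
    simp [reflAt, pow_two]
  have := Fact.mk Nat.prime_two
  have hall := Equiv.Perm.pow_prime_eq_one_iff.1 h2
  have hrep := Multiset.eq_replicate_card.2 hall
  have hsum := Equiv.Perm.sum_cycleType (reflAt p 0)
  set k := (reflAt p 0).cycleType.card with hk
  rw [hsup, hrep, Multiset.sum_replicate, smul_eq_mul] at hsum
  have hk2 : k = (p - 1) / 2 := by omega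
  have hk0 : k ≠ 0 := by omega
  rw [Equiv.Perm.nat_card_centralizer, hrep, Multiset.sum_replicate, ← hk2, ZMod.card, smul_eq_mul,
    hsum, Multiset.prod_replicate, Multiset.toFinset_replicate, if_neg hk0, Finset.prod_singleton,
    Multiset.count_replicate_self, show p - (p - 1) = 1 by omega]
  simp

lemma comm_rot {g : Perm (ZMod p)} (h : g * rot p 1 = rot p 1 * g) : IsStarPoly g := by
  intro x
  have := Equiv.ext_iff.1 h x
  simp only [Equiv.Perm.mul_apply, rot, Equiv.coe_addLeft] at this
  rw [add_comm, this, add_comm]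

lemma comm_rot_one {g : Perm (ZMod p)} (h : g * rot p 1 = rot p 1 * g) (h0 : g 0 = 0) : g = 1 := by
  ext x
  rw [star_eq (comm_rot h), h0]; simp

lemma cent_iff (f : Perm (ZMod p)) :
    f ∈ Subgroup.centralizer {reflAt p 0} ↔ reflAt p 0 * f = f * reflAt p 0 := by
  rw [Subgroup.mem_centralizer_singleton_iff, eq_comm]

lemma cent_zero (hp : 5 ≤ p) {f : Perm (ZMod p)}
    (h : reflAt p 0 * f = f * reflAt p 0) : f 0 = 0 := by
  have : 0 - f 0 = f (0 - 0) := Equiv.ext_iff.1 h 0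
  rw [sub_zero (0 : ZMod p)] at this
  have : 2 * f 0 = 0 := by linear_combination -this
  exact (mul_eq_zero.1 this).resolve_left (two_ne hp)

lemma refl_sq (s : ZMod p) : reflAt p s * reflAt p s = 1 := by
  ext x; simp [reflAt]

lemma refl_inv (s : ZMod p) : (reflAt p s)⁻¹ = reflAt p s :=
  inv_eq_of_mul_eq_one_left (refl_sq s)

lemma ax_rot0 (c s : ZMod p) : Ax s (rot p c) := by
  apply star_ax
  intro x; simp [rot, add_assoc]

lemma card_A (hp : 5 ≤ p) :
    Nat.card {σ : Perm (ZMod p) // IsHC p σ ∧ Ax 0 σ}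
      = 2 ^ ((p - 1) / 2) * ((p - 1) / 2).factorial := by
  rw [← card_centralizer hp]
  symm
  set n := reflAt p 0 with hn
  have hninv : n⁻¹ = n := refl_inv 0
  have hnr : n * rot p 1 * n⁻¹ = (rot p 1)⁻¹ := (refl_conj_iff _ _).2 (ax_rot0 1 0)
  apply Nat.card_eq_of_bijective
    (fun f : Subgroup.centralizer {n} =>
      (⟨f.1 * rot p 1 * f.1⁻¹, hc_conj (hc_rot one_ne_zero) _, by
        have hf := (cent_iff f.1).1 f.2
        rw [← refl_conj_iff]
        have : n * f.1 = f.1 * n := hf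
        calc n * (f.1 * rot p 1 * f.1⁻¹) * n⁻¹
            = (n * f.1) * rot p 1 * (n * f.1)⁻¹ := by group
          _ = f.1 * (n * rot p 1 * n⁻¹) * f.1⁻¹ := by rw [this]; group
          _ = _ := by rw [hnr]; group⟩ : {σ : Perm (ZMod p) // IsHC p σ ∧ Ax 0 σ}))
  constructor
  · rintro ⟨f, hf⟩ ⟨g, hg⟩ h
    have h' : f * rot p 1 * f⁻¹ = g * rot p 1 * g⁻¹ := congrArg Subtype.val h
    have hf0 := cent_zero hp ((cent_iff f).1 hf)
    have hg0 := cent_zero hp ((cent_iff g).1 hg)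
    have h1 : g⁻¹ * f = 1 := by
      apply comm_rot_one
      · calc g⁻¹ * f * rot p 1 = g⁻¹ * (f * rot p 1 * f⁻¹) * f := by group
          _ = _ := by rw [h']; group
      · rw [Equiv.Perm.mul_apply, hf0, Equiv.Perm.inv_eq_iff_eq, hg0]
    ext1
    exact (inv_mul_eq_one.1 h1).symm
  · rintro ⟨σ, hσ, hax⟩
    have hcard : (rot p 1).support.card = σ.support.card := by
      rw [hσ.2, (hc_rot (p := p) one_ne_zero).2]
    obtain ⟨g, hg⟩ := isConj_iff.1
      (Equiv.Perm.IsCycle.isConj (hc_rot (p := p) one_ne_zero).1 hσ.1 hcard)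
    set f := g * rot p (g⁻¹ 0) with hf
    have hf0 : f 0 = 0 := by simp [hf, rot]
    have hfσ : f * rot p 1 * f⁻¹ = σ := by
      have : rot p (g⁻¹ 0) * rot p 1 = rot p 1 * rot p (g⁻¹ 0) := by
        rw [← rot_add, ← rot_add, add_comm]
      calc f * rot p 1 * f⁻¹ = g * (rot p (g⁻¹ 0) * rot p 1) * (rot p (g⁻¹ 0))⁻¹ * g⁻¹ := by
            rw [hf]; group
        _ = g * rot p 1 * g⁻¹ := by rw [this]; group
        _ = σ := hg
    have hnσ : n * σ * n⁻¹ = σ⁻¹ := (refl_conj_iff _ _).2 hax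
    have h1 : f⁻¹ * n * f * n⁻¹ = 1 := by
      apply comm_rot_one
      · have e : n⁻¹ * rot p 1 = (rot p 1)⁻¹ * n⁻¹ := by
          rw [← hnr, hninv]
          have : n * n = 1 := refl_sq 0
          calc n * rot p 1 = n * rot p 1 * (n * n) := by rw [this, mul_one]
            _ = _ := by group
        calc f⁻¹ * n * f * n⁻¹ * rot p 1 = f⁻¹ * n * f * (n⁻¹ * rot p 1) := by group
          _ = f⁻¹ * (n * (f * rot p 1 * f⁻¹) * n⁻¹)⁻¹ * n * f * n⁻¹ := by rw [e]; group
          _ = f⁻¹ * σ * n * f * n⁻¹ := by rw [hfσ, hnσ, inv_inv]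
          _ = _ := by rw [← hfσ]; group
      · rw [hninv]
        have hn0 : n 0 = 0 := by simp [hn, reflAt]
        simp only [Equiv.Perm.mul_apply, hn0, hf0]
        rw [Equiv.Perm.inv_eq_iff_eq, hf0]
    refine ⟨⟨f, (cent_iff f).2 ?_⟩, Subtype.ext hfσ⟩
    change n * f = f * n
    have h2 := mul_inv_eq_one.1 h1
    calc n * f = f * (f⁻¹ * n * f) := by group
      _ = f * n := by rw [h2]

lemma card_stars : Nat.card {σ : Perm (ZMod p) // IsHC p σ ∧ IsStarPoly σ} = p - 1 := by
  have : Nat.card {c : ZMod p // c ≠ 0} = p - 1 := by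
    rw [Nat.card_eq_fintype_card, Fintype.card_subtype_compl]
    simp [ZMod.card]
  rw [← this]
  symm
  apply Nat.card_eq_of_bijective (fun c : {c : ZMod p // c ≠ 0} =>
    (⟨rot p c.1, hc_rot c.2, fun x => by simp [rot, add_assoc]⟩ :
      {σ : Perm (ZMod p) // IsHC p σ ∧ IsStarPoly σ}))
  constructor
  · rintro ⟨c, hc⟩ ⟨d, hd⟩ h
    have h' : rot p c = rot p d := congrArg Subtype.val h
    have := Equiv.ext_iff.1 h' 0
    simp [rot] at this
    exact Subtype.ext this
  · rintro ⟨σ, h, hs⟩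
    refine ⟨⟨σ 0, ?_⟩, ?_⟩
    · have : (0 : ZMod p) ∈ σ.support := by rw [h.2]; exact Finset.mem_univ _
      exact Equiv.Perm.mem_support.1 this
    · ext x
      rw [star_eq hs x]; rfl

lemma card_T (hp : 5 ≤ p) :
    Nat.card {σ : Perm (ZMod p) // IsHC p σ ∧ Ax 0 σ ∧ ¬ IsStarPoly σ} + (p - 1)
      = 2 ^ ((p - 1) / 2) * ((p - 1) / 2).factorial := by
  classical
  rw [← card_A hp, ← card_stars (p := p)]
  simp only [Nat.card_eq_fintype_card, Fintype.card_subtype]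
  rw [← Finset.card_union_of_disjoint]
  · congr 1
    ext σ
    simp only [Finset.mem_union, Finset.mem_filter, Finset.mem_univ, true_and]
    have := fun h : IsStarPoly σ => star_ax h 0
    tauto
  · rw [Finset.disjoint_left]
    intro σ
    simp only [Finset.mem_filter, Finset.mem_univ, true_and]
    tauto

end helpers

/-- the number of rotation classes of Hamiltonian cycles with exactly one
axis of reflective symmetry equals `((p-1)/2) · (2^((p-3)/2) · ((p-3)/2)! - 1)`. -/
theorem stmt6 (p : ℕ) [Fact p.Prime] (hp : 5 ≤ p) :
    Nat.card {q : RotClasses p // ∃ σ : HC p, Quotient.mk (rotSetoid p) σ = q ∧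
        {s : ZMod p | FixedBy p (reflAt p s) σ.1}.ncard = 1}
      = (p - 1) / 2 * (2 ^ ((p - 3) / 2) * Nat.factorial ((p - 3) / 2) - 1) := by
  classical
  let Q := {q : RotClasses p // ∃ σ : HC p, Quotient.mk (rotSetoid p) σ = q ∧
        {s : ZMod p | FixedBy p (reflAt p s) σ.1}.ncard = 1}
  let T := {σ : Perm (ZMod p) // IsHC p σ ∧ Ax 0 σ ∧ ¬ IsStarPoly σ}
  change Nat.card Q = _
  haveI : Finite (HC p) := inferInstanceAs (Finite {σ : Perm (ZMod p) // IsHC p σ})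
  haveI : Finite (RotClasses p) := inferInstanceAs (Finite (Quotient (rotSetoid p)))
  haveI : Finite Q := inferInstanceAs (Finite (Subtype _))
  let F : T → Q := fun σ => ⟨Quotient.mk (rotSetoid p) ⟨σ.1, σ.2.1⟩, ⟨σ.1, σ.2.1⟩, rfl,
    (ncard_iff hp σ.2.1).2 ⟨⟨0, σ.2.2.1⟩, σ.2.2.2⟩⟩
  have hst_inv : ∀ σ : Perm (ZMod p), IsStarPoly σ⁻¹ → IsStarPoly σ := by
    intro σ h x
    have h1 := h (σ x)
    have h2 : σ⁻¹ (σ x) = x := σ.symm_apply_apply x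
    rw [h2, Equiv.Perm.inv_eq_iff_eq] at h1
    exact h1.symm
  have hF : ∀ σ τ : T, F σ = F τ ↔ τ.1 = σ.1 ∨ τ.1 = σ.1⁻¹ := by
    intro σ τ
    constructor
    · intro h
      have h1 : (Quotient.mk (rotSetoid p) ⟨σ.1, σ.2.1⟩) = Quotient.mk (rotSetoid p) ⟨τ.1, τ.2.1⟩ :=
        congrArg Subtype.val h
      obtain ⟨r, hr⟩ := Quotient.exact h1
      change τ.1 = rotAct p r σ.1 ∨ τ.1 = (rotAct p r σ.1)⁻¹ at hr
      have hax : Ax (0 + 2 * r) τ.1 := by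
        rcases hr with hr | hr <;> rw [hr]
        · exact ax_rot σ.2.2.1
        · exact ax_inv (ax_rot σ.2.2.1)
      have hr0 : r = 0 := by
        by_contra hne
        refine τ.2.2.2 (ax_unique hax τ.2.2.1 ?_)
        rw [zero_add]
        exact mul_ne_zero (two_ne hp) hne
      rwa [hr0, rotAct_zero] at hr
    · intro h
      apply Subtype.ext
      apply Quotient.sound
      refine ⟨0, ?_⟩
      rwa [rotAct_zero]
  have hsurj : Function.Surjective F := by
    rintro ⟨q, σ, rfl, hσ⟩
    obtain ⟨⟨s, hs⟩, hst⟩ := (ncard_iff hp σ.2).1 hσ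
    have hax : Ax 0 (rotAct p (-(s / 2)) σ.1) := by
      have h1 := ax_rot (r := -(s / 2)) hs
      have h2 : s + 2 * (-(s / 2)) = 0 := by
        field_simp [two_ne hp]
        ring
      rwa [h2] at h1
    refine ⟨⟨rotAct p (-(s / 2)) σ.1, hc_conj σ.2 _, hax, fun h => hst (star_rot h)⟩, ?_⟩
    apply Subtype.ext
    symm
    apply Quotient.sound
    exact ⟨-(s / 2), Or.inl rfl⟩
  haveI : Fintype Q := Fintype.ofFinite Q
  haveI : Fintype T := Fintype.ofFinite T
  have hcount : Nat.card T = Nat.card Q * 2 := by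
    rw [Nat.card_eq_fintype_card, Nat.card_eq_fintype_card]
    have := Finset.card_eq_sum_card_fiberwise (f := F) (s := Finset.univ) (t := Finset.univ)
      (fun _ _ => by simp)
    rw [← Finset.card_univ, this, Finset.sum_const_nat (m := 2), Finset.card_univ]
    intro q _
    obtain ⟨σ, rfl⟩ := hsurj q
    rw [Finset.card_eq_two]
    refine ⟨σ, ⟨σ.1⁻¹, hc_inv σ.2.1, ax_inv σ.2.2.1, fun h => σ.2.2.2 (hst_inv _ h)⟩, ?_, ?_⟩
    · intro h
      have h1 : σ.1 = σ.1⁻¹ := congrArg Subtype.val h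
      have h2 : σ.1 ^ 2 = 1 := by rw [pow_two]; nth_rw 1 [h1]; simp
      have h3 := orderOf_dvd_of_pow_eq_one h2
      rw [hc_order σ.2.1] at h3
      have := Nat.le_of_dvd (by norm_num) h3
      omega
    · ext τ
      simp only [Finset.mem_filter, Finset.mem_univ, true_and, Finset.mem_insert,
        Finset.mem_singleton]
      rw [eq_comm, hF, Subtype.ext_iff, Subtype.ext_iff]
  have hT : Nat.card T + (p - 1) = _ := card_T hp
  have hodd : p % 2 = 1 := by
    rcases (Fact.out : p.Prime).eq_two_or_odd with h | h <;> omega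
  obtain ⟨k, hk⟩ : ∃ k, p = 2 * k + 3 := ⟨(p - 3) / 2, by omega⟩
  have e1 : (p - 1) / 2 = k + 1 := by omega
  have e2 : (p - 3) / 2 = k := by omega
  have e3 : p - 1 = 2 * (k + 1) := by omega
  rw [hcount, e1, e3, Nat.factorial_succ, pow_succ] at hT
  rw [e1, e2, Nat.mul_sub]
  have e4 : 2 ^ k * 2 * ((k + 1) * k.factorial) = 2 * ((k + 1) * (2 ^ k * k.factorial)) := by ring
  omega
end

section
/- For p = 7, the Hamiltonian cycles on Z/7 up to rotation form exactly 54 equivalence classes, of which 3 are star polygons (with 7 symmetry axes), 21 have exactly one symmetry axis, and 30 are asymmetric. -/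
open Equiv
set_option linter.unusedSectionVars false

variable (p : ℕ) [NeZero p]

/-! Hamiltonian cycles on `ZMod 7` are written as lists of vertices; a class is
represented by a list starting with `0`. -/

/-- Translate a list so that it starts with `0`. -/
def normL (l : List (ZMod 7)) : List (ZMod 7) := l.map (fun x => x - l.headD 0)

/-- All lists starting with `0` which describe a cycle in the rotation class of `l`. -/
def variantsL (l : List (ZMod 7)) : List (List (ZMod 7)) :=
  (List.range 7).map (fun k => normL (l.rotate k)) ++
    (List.range 7).map (fun k => normL (l.reverse.rotate k))

/-- Representatives of the rotation classes. -/
def repsL : List (List (ZMod 7)) :=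
  [[0, 2, 4, 3, 6, 5, 1], [0, 2, 4, 6, 3, 5, 1], [0, 2, 4, 6, 5, 3, 1],
   [0, 2, 5, 3, 6, 4, 1], [0, 2, 5, 4, 6, 3, 1], [0, 2, 5, 6, 3, 4, 1],
   [0, 2, 6, 3, 5, 4, 1], [0, 2, 6, 4, 5, 3, 1], [0, 3, 2, 5, 6, 4, 1],
   [0, 3, 4, 6, 5, 2, 1], [0, 3, 5, 2, 4, 6, 1], [0, 3, 5, 2, 6, 4, 1],
   [0, 3, 5, 4, 2, 6, 1], [0, 3, 5, 4, 6, 2, 1], [0, 3, 5, 6, 2, 4, 1],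
   [0, 3, 5, 6, 4, 2, 1], [0, 3, 6, 2, 5, 4, 1], [0, 3, 6, 4, 1, 5, 2],
   [0, 3, 6, 4, 2, 5, 1], [0, 3, 6, 4, 5, 2, 1], [0, 3, 6, 5, 2, 4, 1],
   [0, 3, 6, 5, 4, 2, 1], [0, 4, 1, 5, 2, 6, 3], [0, 4, 2, 5, 3, 6, 1],
   [0, 4, 2, 5, 6, 3, 1], [0, 4, 2, 6, 3, 5, 1], [0, 4, 2, 6, 5, 3, 1],
   [0, 4, 3, 5, 6, 2, 1], [0, 4, 3, 6, 5, 2, 1], [0, 4, 5, 2, 6, 3, 1],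
   [0, 4, 5, 3, 6, 2, 1], [0, 4, 5, 6, 3, 2, 1], [0, 4, 6, 2, 5, 3, 1],
   [0, 4, 6, 3, 1, 5, 2], [0, 4, 6, 3, 5, 2, 1], [0, 4, 6, 5, 2, 3, 1],
   [0, 4, 6, 5, 3, 2, 1], [0, 5, 2, 4, 6, 3, 1], [0, 5, 2, 6, 3, 4, 1],
   [0, 5, 2, 6, 4, 3, 1], [0, 5, 3, 1, 6, 4, 2], [0, 5, 3, 4, 2, 6, 1],
   [0, 5, 3, 4, 6, 2, 1], [0, 5, 3, 6, 1, 4, 2], [0, 5, 3, 6, 2, 4, 1],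
   [0, 5, 3, 6, 4, 2, 1], [0, 5, 4, 6, 2, 3, 1], [0, 5, 4, 6, 3, 2, 1],
   [0, 5, 6, 2, 4, 3, 1], [0, 5, 6, 3, 2, 4, 1], [0, 5, 6, 3, 4, 2, 1],
   [0, 5, 6, 4, 2, 3, 1], [0, 5, 6, 4, 3, 2, 1], [0, 6, 5, 4, 3, 2, 1]]

/-- The reflection at `s` fixes the undirected cycle described by `l`. -/
def fixL (l : List (ZMod 7)) (s : ZMod 7) : Prop :=
  l.map (fun x => s - x) ~r l ∨ l.map (fun x => s - x) ~r l.reverse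

instance (l : List (ZMod 7)) : DecidablePred (fixL l) := fun s => by
  unfold fixL; infer_instance

theorem check_valid : ∀ l ∈ repsL, l.Nodup ∧ l.length = 7 ∧ l.head? = some 0 := by
  decide +kernel

theorem check_nodup : repsL.Nodup := by decide +kernel

/-- Injective code of a list. -/
def encL : List (ZMod 7) → ℕ
  | [] => 0
  | x :: l => 8 * encL l + (x.val + 1)

theorem encL_inj : Function.Injective encL := by
  intro l
  induction l with
  | nil =>
    intro m h
    cases m with
    | nil => rfl
    | cons y m => simp only [encL] at h; omega
  | cons x l ih =>
    intro m h
    cases m with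
    | nil => simp only [encL] at h; omega
    | cons y m =>
      simp only [encL] at h
      have hx := ZMod.val_lt x
      have hy := ZMod.val_lt y
      have h1 : encL l = encL m := by omega
      have h2 : x.val = y.val := by omega
      rw [ih h1, ZMod.val_injective 7 h2]

/-- Code of the list `l` translated by `7 - h`. -/
def encShift (h : ℕ) : List ℕ → ℕ
  | [] => 0
  | x :: l => 8 * encShift h l + ((x + (7 - h)) % 7 + 1)

theorem val_sub_eq : ∀ x y : ZMod 7, (x - y).val = (x.val + (7 - y.val)) % 7 := by
  decide +kernel

theorem encL_map_sub (y : ZMod 7) (l : List (ZMod 7)) :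
    encL (l.map (fun x => x - y)) = encShift y.val (l.map ZMod.val) := by
  induction l with
  | nil => rfl
  | cons x l ih => simp only [List.map_cons, encL, encShift, ih, val_sub_eq]

/-- Code of the normalized list. -/
def encNorm (l : List ℕ) : ℕ := encShift (l.headD 0) l

theorem encL_normL (l : List (ZMod 7)) : encL (normL l) = encNorm (l.map ZMod.val) := by
  rw [normL, encL_map_sub, encNorm]
  cases l <;> rfl

/-- Codes of all variants. -/
def variantCodes (l : List ℕ) : List ℕ :=
  (List.range 7).map (fun k => encNorm (l.rotate k)) ++
    (List.range 7).map (fun k => encNorm (l.reverse.rotate k))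

theorem variantCodes_eq (l : List (ZMod 7)) :
    (variantsL l).map encL = variantCodes (l.map ZMod.val) := by
  simp only [variantsL, variantCodes, List.map_append, List.map_map, Function.comp_def,
    encL_normL, List.map_rotate, List.map_reverse]

/-- Minimum of a list of numbers, given a default. -/
def minCode (a : ℕ) : List ℕ → ℕ
  | [] => a
  | x :: l => minCode (cond (Nat.ble a x) a x) l

theorem minCode_mem (l : List ℕ) : ∀ a, minCode a l ∈ a :: l := by
  induction l with
  | nil => simp [minCode]
  | cons x l ih =>
    intro a
    have := ih (cond (Nat.ble a x) a x)
    simp only [minCode]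
    cases h : Nat.ble a x <;> simp only [h, cond_true, cond_false, List.mem_cons] at this ⊢ <;>
      tauto

/-- Codes of the representatives. -/
def repCodes : List ℕ := [751961, 741209, 683865, 719257, 687001, 708505, 715225, 682969, 720097,
  651105, 776097, 718753, 768929, 654241, 704417, 647073, 714721, 994273,
  736225, 650209, 703969, 646625, 1293481, 773353, 687337, 741097, 683753,
  654633, 651049, 685993, 653737, 642985, 681961, 993769, 649705, 671209,
  642537, 686833, 708337, 679665, 980273, 768817, 654129, 962353, 704305,
  646961, 671601, 642929, 677873, 702961, 645617, 670705, 642033, 641977]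

theorem repCodes_eq : repsL.map encL = repCodes := by decide +kernel

/-- Boolean membership test. -/
def memB (c : ℕ) (l : List ℕ) : Bool := l.any (Nat.beq c)

theorem memB_iff (c : ℕ) (l : List ℕ) : memB c l = true ↔ c ∈ l := by
  simp [memB, List.any_eq_true]

theorem check_sep_codes : (repsL.all fun l =>
    (variantCodes (l.map ZMod.val)).all fun c =>
      Nat.beq c (encL l) || !(memB c repCodes)) = true := by
  decide +kernel

theorem check_cover_codes : ((List.permutations' [1, 2, 3, 4, 5, 6]).all fun l =>
    memB (minCode (encNorm (0 :: l)) (variantCodes (0 :: l))) repCodes) = true := by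
  decide +kernel

theorem check_sep : ∀ l ∈ repsL, ∀ m ∈ repsL, m ∈ variantsL l → m = l := by
  intro l hl m hm hv
  have h := List.all_eq_true.1 (List.all_eq_true.1 check_sep_codes l hl) (encL m)
    (by rw [← variantCodes_eq]; exact List.mem_map_of_mem hv)
  have h2 : memB (encL m) repCodes = true := by
    rw [memB_iff, ← repCodes_eq]; exact List.mem_map_of_mem hm
  rw [h2] at h
  exact encL_inj (by simpa using h)

theorem check_cover : ∀ l ∈ List.permutations' ([1, 2, 3, 4, 5, 6] : List (ZMod 7)),
    ∃ m ∈ repsL, m ∈ variantsL (0 :: l) := by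
  intro l hl
  have h1 : l.map ZMod.val ∈ List.permutations' [1, 2, 3, 4, 5, 6] := by
    rw [List.mem_permutations'] at hl ⊢
    exact hl.map ZMod.val
  have h := List.all_eq_true.1 check_cover_codes _ h1
  rw [memB_iff, ← repCodes_eq, List.mem_map] at h
  obtain ⟨m, hm, he⟩ := h
  refine ⟨m, hm, ?_⟩
  have hin : encL m ∈ variantCodes ((0 :: l).map ZMod.val) := by
    rw [he]
    have := minCode_mem (variantCodes (0 :: l.map ZMod.val)) (encNorm (0 :: l.map ZMod.val))
    rcases List.mem_cons.1 this with h | h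
    · rw [h]
      simp only [variantCodes, List.mem_append, List.mem_map, List.mem_range]
      exact Or.inl ⟨0, by norm_num, by simp⟩
    · exact h
  rw [← variantCodes_eq, List.mem_map] at hin
  obtain ⟨v, hv, hve⟩ := hin
  rwa [← encL_inj hve]

/-- Number of symmetry axes. -/
def axesL (l : List (ZMod 7)) : ℕ := (Finset.univ.filter (fixL l)).card

/-- The cycle is a star polygon. -/
def isStarL (l : List (ZMod 7)) : Prop := ∃ d : ZMod 7, ∀ x, l.formPerm x = d + x

instance : DecidablePred isStarL := fun l => by unfold isStarL; infer_instance

theorem check_star : (repsL.filter (fun l => axesL l = 7 ∧ isStarL l)).length = 3 := by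
  decide +kernel
theorem check_one : (repsL.filter (fun l => axesL l = 1)).length = 21 := by
  decide +kernel
theorem check_zero : (repsL.filter (fun l => axesL l = 0)).length = 30 := by
  decide +kernel

theorem formPerm_map_conj (g : Perm (ZMod 7)) (l : List (ZMod 7)) :
    g * l.formPerm * g⁻¹ = (l.map g).formPerm := by
  induction l with
  | nil => simp
  | cons x l ih =>
    cases l with
    | nil => simp
    | cons y l =>
      simp only [List.map_cons, List.formPerm_cons_cons] at ih ⊢
      rw [← ih, Equiv.swap_apply_apply]
      group

theorem isHC_formPerm (l : List (ZMod 7)) (hn : l.Nodup) (hl : l.length = 7) :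
    IsHC 7 l.formPerm := by
  refine ⟨List.isCycle_formPerm hn (by omega), ?_⟩
  rw [List.support_formPerm_of_nodup l hn (by rintro x rfl; simp at hl)]
  apply Finset.eq_univ_of_card
  rw [List.toFinset_card_of_nodup hn, hl]; rfl

theorem formPerm_eq_iff {l m : List (ZMod 7)} (hn : l.Nodup) (hl : l.length = 7)
    (hm : m.Nodup) : l.formPerm = m.formPerm ↔ l ~r m := by
  rw [List.formPerm_eq_formPerm_iff hn hm]
  constructor
  · rintro (h | h)
    · exact h
    · omega
  · exact Or.inl

theorem exists_list (σ : Perm (ZMod 7)) (h : IsHC 7 σ) :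
    ∃ l ∈ List.permutations' ([1, 2, 3, 4, 5, 6] : List (ZMod 7)),
      σ = (0 :: l).formPerm := by
  have h0 : (0 : ZMod 7) ∈ σ.support := by rw [h.2]; exact Finset.mem_univ _
  have hc : σ.cycleOf 0 = σ := h.1.cycleOf_eq (by simpa using h0)
  have hf := Equiv.Perm.formPerm_toList σ 0
  rw [hc] at hf
  have hn := Equiv.Perm.nodup_toList σ 0
  have hz : (σ.toList 0)[0]? = some 0 := by
    rw [List.getElem?_eq_getElem (Equiv.Perm.length_toList_pos_of_mem_support _ _ h0),
      Equiv.Perm.toList_getElem_zero _ _ h0]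
  have hmem : ∀ y, y ∈ σ.toList 0 := by
    intro y
    rw [Equiv.Perm.mem_toList_iff]
    refine ⟨h.1.sameCycle (by simpa using h0) ?_, h0⟩
    have : y ∈ σ.support := by rw [h.2]; exact Finset.mem_univ _
    simpa using this
  generalize σ.toList 0 = L at *
  cases L with
  | nil => exact absurd (hmem 0) (by simp)
  | cons a l =>
    simp at hz
    subst hz
    refine ⟨l, ?_, hf.symm⟩
    rw [List.mem_permutations', List.perm_ext_iff_of_nodup (List.nodup_cons.1 hn).2 (by decide)]
    intro y
    have h1 : y ∈ l ↔ y ≠ 0 := by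
      constructor
      · rintro hy rfl; exact (List.nodup_cons.1 hn).1 hy
      · intro hy; exact (List.mem_cons.1 (hmem y)).resolve_left hy
    rw [h1]
    clear h1
    revert y
    decide

theorem normL_eq {l m : List (ZMod 7)} {r : ZMod 7} (h : m = l.map (fun x => r + x))
    (h0 : m.head? = some 0) : m = normL l := by
  cases l with
  | nil => simp [h] at h0
  | cons a l =>
    rw [h] at h0 ⊢
    simp only [List.map_cons, List.head?_cons, Option.some.injEq] at h0
    have hr : r = -a := eq_neg_of_add_eq_zero_left h0
    subst hr
    simp only [normL, List.headD_cons]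
    apply List.map_congr_left
    intro x _
    ring

theorem mem_variantsL {l m : List (ZMod 7)} (hl : l.length = 7) (h0 : m.head? = some 0)
    (r : ZMod 7) (h : l.map (fun x => r + x) ~r m ∨ (l.map (fun x => r + x)).reverse ~r m) :
    m ∈ variantsL l := by
  have key : ∀ k : List (ZMod 7), k.length = 7 → k.map (fun x => r + x) ~r m →
      m ∈ (List.range 7).map (fun n => normL (k.rotate n)) := by
    intro k hk ⟨n, hn⟩
    rw [List.mem_map]
    refine ⟨n % 7, List.mem_range.2 (Nat.mod_lt _ (by norm_num)), ?_⟩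
    have : k.rotate (n % 7) = k.rotate n := by
      have := List.rotate_mod k n
      rwa [hk] at this
    rw [this]
    exact (normL_eq (by rw [List.map_rotate, hn]) h0).symm
  rw [variantsL, List.mem_append]
  rcases h with h | h
  · exact Or.inl (key l hl h)
  · exact Or.inr (key l.reverse (by simpa using hl) (by rwa [List.map_reverse]))

theorem of_mem_variantsL {l m : List (ZMod 7)} (h : m ∈ variantsL l) :
    ∃ r : ZMod 7, l.map (fun x => r + x) ~r m ∨ (l.map (fun x => r + x)).reverse ~r m := by
  have key : ∀ k : List (ZMod 7), m ∈ (List.range 7).map (fun n => normL (k.rotate n)) →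
      ∃ r : ZMod 7, k.map (fun x => r + x) ~r m := by
    intro k hk
    obtain ⟨n, -, rfl⟩ := List.mem_map.1 hk
    refine ⟨-(k.rotate n).headD 0, n, ?_⟩
    rw [← List.map_rotate, normL]
    apply List.map_congr_left
    intro x _
    ring
  rw [variantsL, List.mem_append] at h
  rcases h with h | h
  · obtain ⟨r, hr⟩ := key _ h
    exact ⟨r, Or.inl hr⟩
  · obtain ⟨r, hr⟩ := key _ h
    exact ⟨r, Or.inr (by rwa [← List.map_reverse])⟩

theorem rotAct_formPerm (r : ZMod 7) (l : List (ZMod 7)) :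
    rotAct 7 r l.formPerm = (l.map (fun x => r + x)).formPerm :=
  formPerm_map_conj (rot 7 r) l

theorem nodup_shift {l : List (ZMod 7)} (hn : l.Nodup) (r : ZMod 7) :
    (l.map (fun x => r + x)).Nodup := hn.map (add_right_injective r)

theorem fixedBy_formPerm {l : List (ZMod 7)} (hn : l.Nodup) (hl : l.length = 7) (s : ZMod 7) :
    FixedBy 7 (reflAt 7 s) l.formPerm ↔ fixL l s := by
  have h1 : (l.map (fun x => s - x)).Nodup := hn.map sub_right_injective
  have h2 : (l.map (fun x => s - x)).length = 7 := by simpa using hl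
  have h3 : reflAt 7 s * l.formPerm * (reflAt 7 s)⁻¹ = (l.map (fun x => s - x)).formPerm :=
    formPerm_map_conj (reflAt 7 s) l
  rw [FixedBy, h3, ← List.formPerm_reverse, formPerm_eq_iff h1 h2 hn,
    formPerm_eq_iff h1 h2 (List.nodup_reverse.2 hn), fixL]

theorem fixedBy_inv (g σ : Perm (ZMod 7)) : FixedBy 7 g σ⁻¹ ↔ FixedBy 7 g σ := by
  have h : g * σ⁻¹ * g⁻¹ = (g * σ * g⁻¹)⁻¹ := by group
  rw [FixedBy, FixedBy, h, inv_inj, inv_eq_iff_eq_inv, inv_inv]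

theorem fixedBy_conj (h g σ : Perm (ZMod 7)) :
    FixedBy 7 (h * g * h⁻¹) (h * σ * h⁻¹) ↔ FixedBy 7 g σ := by
  have h1 : h * g * h⁻¹ * (h * σ * h⁻¹) * (h * g * h⁻¹)⁻¹ = h * (g * σ * g⁻¹) * h⁻¹ := by group
  have h2 : (h * σ * h⁻¹)⁻¹ = h * σ⁻¹ * h⁻¹ := by group
  rw [FixedBy, FixedBy, h1, h2]
  simp only [mul_left_inj, mul_right_inj]

theorem reflAt_conj (r s : ZMod 7) :
    rot 7 r * reflAt 7 s * (rot 7 r)⁻¹ = reflAt 7 (s + 2 * r) := by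
  rw [← rot_neg]
  ext x
  simp only [rot, reflAt, Perm.mul_apply, Equiv.coe_addLeft, Equiv.subLeft_apply]
  ring

/-- The set of axes of a cycle. -/
def axesSet (σ : Perm (ZMod 7)) : Set (ZMod 7) := {s | FixedBy 7 (reflAt 7 s) σ}

theorem axesSet_inv (σ : Perm (ZMod 7)) : axesSet σ⁻¹ = axesSet σ := by
  ext s; exact fixedBy_inv _ _

theorem axesSet_rotAct (r : ZMod 7) (σ : Perm (ZMod 7)) :
    (axesSet (rotAct 7 r σ)).ncard = (axesSet σ).ncard := by
  have : axesSet (rotAct 7 r σ) = (fun s => s + 2 * r) '' axesSet σ := by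
    have key : ∀ s, s + 2 * r ∈ axesSet (rotAct 7 r σ) ↔ s ∈ axesSet σ := by
      intro s
      change FixedBy 7 (reflAt 7 (s + 2 * r)) (rot 7 r * σ * (rot 7 r)⁻¹) ↔ _
      rw [← reflAt_conj, fixedBy_conj]
      rfl
    ext s
    constructor
    · intro hs
      refine ⟨s - 2 * r, (key _).1 ?_, ?_⟩ <;> simp [hs]
    · rintro ⟨t, ht, rfl⟩
      exact (key t).2 ht
  rw [this, Set.ncard_image_of_injective _ (add_left_injective _)]

theorem axes_rel {σ τ : HC 7} (h : (rotSetoid 7).r σ τ) :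
    (axesSet σ.1).ncard = (axesSet τ.1).ncard := by
  obtain ⟨r, h | h⟩ := h
  · rw [h, axesSet_rotAct]
  · rw [h, axesSet_inv, axesSet_rotAct]

/-- `σ` is a translation, up to orientation. -/
def isTrans (σ : Perm (ZMod 7)) : Prop :=
  ∃ d : ZMod 7, σ = Equiv.addLeft d ∨ σ = (Equiv.addLeft d)⁻¹

theorem isTrans_iff (σ : Perm (ZMod 7)) : isTrans σ ↔ ∃ d : ZMod 7, ∀ x, σ x = d + x := by
  constructor
  · rintro ⟨d, rfl | rfl⟩
    · exact ⟨d, fun x => rfl⟩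
    · exact ⟨-d, fun x => rfl⟩
  · rintro ⟨d, h⟩
    exact ⟨d, Or.inl (Equiv.ext h)⟩

theorem isTrans_inv {σ : Perm (ZMod 7)} (h : isTrans σ) : isTrans σ⁻¹ := by
  obtain ⟨d, rfl | rfl⟩ := h
  · exact ⟨d, Or.inr rfl⟩
  · exact ⟨d, Or.inl (inv_inv _)⟩

theorem isTrans_rotAct {σ : Perm (ZMod 7)} (r : ZMod 7) (h : isTrans σ) :
    isTrans (rotAct 7 r σ) := by
  rw [isTrans_iff] at h ⊢
  obtain ⟨d, h⟩ := h
  refine ⟨d, fun x => ?_⟩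
  rw [rotAct, ← rot_neg]
  simp only [Perm.mul_apply, h, rot, Equiv.coe_addLeft]
  ring

theorem trans_rel {σ τ : HC 7} (h : (rotSetoid 7).r σ τ) (hs : isTrans σ.1) :
    isTrans τ.1 := by
  obtain ⟨r, h | h⟩ := h
  · rw [h]; exact isTrans_rotAct r hs
  · rw [h]; exact isTrans_inv (isTrans_rotAct r hs)

theorem axes_formPerm {l : List (ZMod 7)} (hn : l.Nodup) (hl : l.length = 7) :
    (axesSet l.formPerm).ncard = axesL l := by
  have : axesSet l.formPerm = ((Finset.univ.filter (fixL l) : Finset (ZMod 7)) : Set (ZMod 7)) := by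
    ext s
    rw [Finset.mem_coe, Finset.mem_filter, ← fixedBy_formPerm hn hl s]
    exact ⟨fun h => ⟨Finset.mem_univ _, h⟩, fun h => h.2⟩
  rw [this, Set.ncard_coe_finset, axesL]

/-- The cycle of a representative. -/
def repHC (l : List (ZMod 7)) (h : l ∈ repsL) : HC 7 :=
  ⟨l.formPerm, isHC_formPerm l (check_valid l h).1 (check_valid l h).2.1⟩

theorem rep_cover (σ : HC 7) : ∃ l, ∃ h : l ∈ repsL, (rotSetoid 7).r σ (repHC l h) := by
  obtain ⟨l, hl, hσ⟩ := exists_list σ.1 σ.2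
  obtain ⟨m, hm, hv⟩ := check_cover l hl
  refine ⟨m, hm, ?_⟩
  obtain ⟨r, hr⟩ := of_mem_variantsL hv
  have hmn := (check_valid m hm).1
  refine ⟨r, ?_⟩
  change m.formPerm = rotAct 7 r σ.1 ∨ m.formPerm = (rotAct 7 r σ.1)⁻¹
  rw [hσ, rotAct_formPerm, ← List.formPerm_reverse]
  rcases hr with hr | hr
  · exact Or.inl (List.formPerm_eq_of_isRotated hmn hr.symm)
  · exact Or.inr (List.formPerm_eq_of_isRotated hmn hr.symm)

theorem rep_sep {l m : List (ZMod 7)} (hl : l ∈ repsL) (hm : m ∈ repsL)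
    (h : (rotSetoid 7).r (repHC l hl) (repHC m hm)) : m = l := by
  obtain ⟨hn, hl7, -⟩ := check_valid l hl
  obtain ⟨hmn, hm7, hm0⟩ := check_valid m hm
  apply check_sep l hl m hm
  obtain ⟨r, h⟩ := h
  apply mem_variantsL hl7 hm0 r
  change m.formPerm = rotAct 7 r l.formPerm ∨ m.formPerm = (rotAct 7 r l.formPerm)⁻¹ at h
  rw [rotAct_formPerm, ← List.formPerm_reverse] at h
  rcases h with h | h
  · exact Or.inl ((formPerm_eq_iff hmn hm7 (nodup_shift hn r)).1 h).symm
  · exact Or.inr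
      ((formPerm_eq_iff hmn hm7 (List.nodup_reverse.2 (nodup_shift hn r))).1 h).symm

/-- Counting classes by counting representatives. -/
theorem count_classes (P : HC 7 → Prop) (B : List (ZMod 7) → Bool)
    (hP : ∀ σ τ, (rotSetoid 7).r σ τ → P σ → P τ)
    (hB : ∀ l (h : l ∈ repsL), P (repHC l h) ↔ B l = true) :
    Nat.card {q : RotClasses 7 // ∃ σ : HC 7, Quotient.mk (rotSetoid 7) σ = q ∧ P σ} =
      (repsL.filter B).length := by
  have hmem : ∀ x : {l // l ∈ (repsL.filter B).toFinset}, x.1 ∈ repsL ∧ B x.1 = true := by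
    rintro ⟨l, hl⟩
    simpa using hl
  let f : {l // l ∈ (repsL.filter B).toFinset} →
      {q : RotClasses 7 // ∃ σ : HC 7, Quotient.mk (rotSetoid 7) σ = q ∧ P σ} := fun x =>
    ⟨Quotient.mk (rotSetoid 7) (repHC x.1 (hmem x).1), _, rfl, (hB _ _).2 (hmem x).2⟩
  have hf : Function.Bijective f := by
    constructor
    · intro x y hxy
      have h := Quotient.exact (congrArg Subtype.val hxy)
      exact (Subtype.ext (rep_sep (hmem x).1 (hmem y).1 h)).symm
    · rintro ⟨q, σ, rfl, hσ⟩
      obtain ⟨l, hl, hr⟩ := rep_cover σ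
      have hb : B l = true := (hB l hl).1 (hP _ _ hr hσ)
      refine ⟨⟨l, by simp [hl, hb]⟩, Subtype.ext ?_⟩
      exact (Quotient.sound (s := rotSetoid 7) hr).symm
  rw [← Nat.card_eq_of_bijective f hf, Nat.card_eq_fintype_card, Fintype.card_coe,
    List.toFinset_card_of_nodup (check_nodup.filter _)]

theorem axes_rep (l : List (ZMod 7)) (h : l ∈ repsL) :
    (axesSet (repHC l h).1).ncard = axesL l :=
  axes_formPerm (check_valid l h).1 (check_valid l h).2.1

/-- for `p = 7` there are exactly `54` rotation classes, of which `3` are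
star polygons (with `7` axes of symmetry), `21` have exactly one axis, and `30` are
asymmetric. -/
theorem stmt9 :
    Nat.card (RotClasses 7) = 54 ∧
    Nat.card {q : RotClasses 7 // ∃ σ : HC 7, Quotient.mk (rotSetoid 7) σ = q ∧
        {s : ZMod 7 | FixedBy 7 (reflAt 7 s) σ.1}.ncard = 7 ∧
        ∃ d : ZMod 7, σ.1 = Equiv.addLeft d ∨ σ.1 = (Equiv.addLeft d)⁻¹} = 3 ∧
    Nat.card {q : RotClasses 7 // ∃ σ : HC 7, Quotient.mk (rotSetoid 7) σ = q ∧
        {s : ZMod 7 | FixedBy 7 (reflAt 7 s) σ.1}.ncard = 1} = 21 ∧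
    Nat.card {q : RotClasses 7 // ∃ σ : HC 7, Quotient.mk (rotSetoid 7) σ = q ∧
        ∀ s : ZMod 7, ¬ FixedBy 7 (reflAt 7 s) σ.1} = 30 := by

  refine ⟨?_, ?_, ?_, ?_⟩
  · have h := count_classes (fun _ => True) (fun _ => true) (fun _ _ _ _ => trivial)
      (fun _ _ => by simp)
    have hlen : (repsL.filter (fun _ => true)).length = 54 := by decide +kernel
    rw [hlen] at h
    rw [← h]
    refine (Nat.card_congr (Equiv.subtypeUnivEquiv ?_)).symm
    intro q
    obtain ⟨σ, hσ⟩ := Quotient.exists_rep q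
    exact ⟨σ, hσ, trivial⟩
  · rw [← check_star]
    refine count_classes (fun σ => (axesSet σ.1).ncard = 7 ∧ isTrans σ.1) _ ?_ ?_
    · rintro σ τ h ⟨h1, h2⟩
      exact ⟨(axes_rel h).symm.trans h1, trans_rel h h2⟩
    · intro l h
      rw [axes_rep, isTrans_iff, decide_eq_true_iff]
      rfl
  · rw [← check_one]
    refine count_classes (fun σ => (axesSet σ.1).ncard = 1) _ ?_ ?_
    · intro σ τ h h1
      exact (axes_rel h).symm.trans h1
    · intro l h
      rw [axes_rep, decide_eq_true_iff]
  · rw [← check_zero]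
    have hz : ∀ σ : HC 7, (∀ s : ZMod 7, ¬ FixedBy 7 (reflAt 7 s) σ.1) ↔
        (axesSet σ.1).ncard = 0 := by
      intro σ
      rw [Set.ncard_eq_zero (Set.toFinite _), Set.eq_empty_iff_forall_notMem]
      rfl
    refine count_classes (fun σ => ∀ s : ZMod 7, ¬ FixedBy 7 (reflAt 7 s) σ.1) _ ?_ ?_
    · intro σ τ h h1
      rw [hz] at h1 ⊢
      exact (axes_rel h).symm.trans h1
    · intro l h
      rw [hz, axes_rep, decide_eq_true_iff]
end
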